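/- Let a, b, c ∈ ℝ and r > 0, and define f(v) = −a² − b² + c² + r² + 4cr·cos(v) + 2r²·cos(v)² and g(u,v) = −a² − b² + c² + 4cr·cos(v)³ + 3r²·cos(2v) − 4r·(a·cos(u) + b·sin(u))·sin(v)³. If √(a²+b²) > 2r + √(c²+r²) or |c| > 2r + √(a²+b²+r²), then f(v) ≠ 0 and g(u,v) ≠ 0 for all u ∈ ℝ and v ∈ [0, π]; consequently the parabolic set of i_M(S(p₀,r)), with p₀ = (a,b,c), is empty. -/

import Mathlib

noncomputable section

/-- The Minkowski bilinear form on `ℝ³`. -/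
def B (p q : EuclideanSpace ℝ (Fin 3)) : ℝ := p 0 * q 0 + p 1 * q 1 - p 2 * q 2

/-- The Minkowski quadratic form. -/
def Q (p : EuclideanSpace ℝ (Fin 3)) : ℝ := B p p

/-- The light cone. -/
def LC : Set (EuclideanSpace ℝ (Fin 3)) := {p | Q p = 0}

/-- The Möbius inversion `i_M(p) = p / Q(p)`. -/
def iM (p : EuclideanSpace ℝ (Fin 3)) : EuclideanSpace ℝ (Fin 3) := (Q p)⁻¹ • p

/-- The standard parametrization of the Euclidean sphere with center `(a,b,c)`
and radius `r`. -/
def φp (a b c r u v : ℝ) : EuclideanSpace ℝ (Fin 3) :=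
  (WithLp.equiv 2 (Fin 3 → ℝ)).symm
    ![r * Real.cos u * Real.sin v + a, r * Real.sin u * Real.sin v + b, r * Real.cos v + c]

/-- The factor `f(v)` of the parabolic-set equation of the Möbius inversion of
the sphere. -/
def fP (a b c r v : ℝ) : ℝ :=
  -a ^ 2 - b ^ 2 + c ^ 2 + r ^ 2 + 4 * c * r * Real.cos v + 2 * r ^ 2 * Real.cos v ^ 2

/-- The factor `g(u,v)` of the parabolic-set equation of the Möbius inversion of
the sphere. -/
def gP (a b c r u v : ℝ) : ℝ :=
  -a ^ 2 - b ^ 2 + c ^ 2 + 4 * c * r * Real.cos v ^ 3 + 3 * r ^ 2 * Real.cos (2 * v) -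
    4 * r * (a * Real.cos u + b * Real.sin u) * Real.sin v ^ 3

/-- The parabolic set of `i_M(S(p₀,r))`: by the computation of the Gaussian
curvature (with respect to the Minkowski metric), the point `i_M(φ(u,v))` is
parabolic if and only if `f(v) = 0` or `g(u,v) = 0`. -/
def parabolicSet (a b c r : ℝ) : Set (EuclideanSpace ℝ (Fin 3)) :=
  {q | ∃ u : ℝ, ∃ v ∈ Set.Ioo 0 Real.pi, φp a b c r u v ∉ LC ∧
        q = iM (φp a b c r u v) ∧ (fP a b c r v = 0 ∨ gP a b c r u v = 0)}

lemma cube_le_sq_of_le_one {t : ℝ} (h0 : 0 ≤ t) (h1 : t ≤ 1) : t ^ 3 ≤ t ^ 2 :=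
  pow_le_pow_of_le_one h0 h1 (by norm_num)

/-- Upper bound behind the negativity of `fP` for a sphere far from the axis. -/
lemma f_bound_neg {ρ k r s x : ℝ} (hr : 0 < r) (hk : 0 ≤ k) (hs : 0 ≤ s)
    (hss : s ^ 2 = k ^ 2 + r ^ 2) (hx0 : 0 ≤ x) (hx1 : x ≤ 1) (h : 2 * r + s < ρ) :
    -ρ ^ 2 + k ^ 2 + r ^ 2 + 4 * k * r * x + 2 * r ^ 2 * x ^ 2 < 0 := by
  have hks : k ≤ s := by nlinarith
  have h1 : (2 * r + s) ^ 2 < ρ ^ 2 := by gcongr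
  have h2 : k * x ≤ s := by nlinarith
  have h3 : r * (k * x) ≤ r * s := by gcongr
  have h4 : r ^ 2 * x ^ 2 ≤ r ^ 2 * 1 := by gcongr; nlinarith
  nlinarith [pow_pos hr 2]

/-- Upper bound behind the negativity of `gP` for a sphere far from the axis. -/
lemma g_bound_neg {ρ k r s x y : ℝ} (hr : 0 < r) (hk : 0 ≤ k) (hs : 0 ≤ s)
    (hss : s ^ 2 = k ^ 2 + r ^ 2) (hx0 : 0 ≤ x) (hy0 : 0 ≤ y) (hxy : x ^ 2 + y ^ 2 = 1)
    (h : 2 * r + s < ρ) :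
    -ρ ^ 2 + k ^ 2 + 4 * k * r * x ^ 3 + 3 * r ^ 2 * (2 * x ^ 2 - 1) + 4 * r * ρ * y ^ 3 < 0 := by
  have hks : k ≤ s := by nlinarith
  have hrs : r ≤ s := by nlinarith
  have hx1 : x ≤ 1 := by nlinarith
  have hy1 : y ≤ 1 := by nlinarith
  have hx := cube_le_sq_of_le_one hx0 hx1
  have hy := cube_le_sq_of_le_one hy0 hy1
  have h1 : (2 * r * (1 - y ^ 3) + s) ^ 2 < (ρ - 2 * r * y ^ 3) ^ 2 := by
    have : 0 ≤ 2 * r * (1 - y ^ 3) :=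
      mul_nonneg (by positivity) (by nlinarith)
    apply pow_lt_pow_left₀ _ (by positivity) (by norm_num)
    linarith
  have h2 : r * (k * x ^ 3) ≤ r * (s * x ^ 3) := by gcongr
  have h3 : r * (r * (1 - x ^ 3 - y ^ 3)) ≤ r * (s * (1 - x ^ 3 - y ^ 3)) := by
    gcongr; linarith
  have h4 : 0 ≤ r ^ 2 * (12 - 12 * y ^ 3 - 4 * x ^ 3 - 6 * x ^ 2) :=
    mul_nonneg (by positivity) (by nlinarith)
  linarith

/-- Lower bound behind the positivity of `fP` for a sphere far from the plane `z = 0`. -/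
lemma f_bound_pos {ρ k r s x : ℝ} (hr : 0 < r) (hs : 0 ≤ s)
    (hss : s ^ 2 = ρ ^ 2 + r ^ 2) (hx1 : x ≤ 1) (h : 2 * r + s < k) :
    0 < -ρ ^ 2 + k ^ 2 + r ^ 2 - 4 * k * r * x + 2 * r ^ 2 * x ^ 2 := by
  have hrs : r ≤ s := by nlinarith
  have h1 : (2 * r * (1 - x) + s) ^ 2 < (k - 2 * r * x) ^ 2 := by
    have : 0 ≤ 2 * r * (1 - x) := mul_nonneg (by positivity) (by linarith)
    apply pow_lt_pow_left₀ _ (by positivity) (by norm_num)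
    linarith
  have h2 : r * (r * (1 - x)) ≤ r * (s * (1 - x)) := by gcongr
  have h3 : 0 ≤ r ^ 2 * ((1 - x) * (5 - x)) :=
    mul_nonneg (by positivity) (mul_nonneg (by linarith) (by linarith))
  linarith

/-- Lower bound behind the positivity of `gP` for a sphere far from the plane `z = 0`. -/
lemma g_bound_pos {ρ k r s x y : ℝ} (hr : 0 < r) (hρ : 0 ≤ ρ) (hs : 0 ≤ s)
    (hss : s ^ 2 = ρ ^ 2 + r ^ 2) (hx0 : 0 ≤ x) (hy0 : 0 ≤ y) (hxy : x ^ 2 + y ^ 2 = 1)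
    (h : 2 * r + s < k) :
    0 < -ρ ^ 2 + k ^ 2 - 4 * k * r * x ^ 3 + 3 * r ^ 2 * (2 * x ^ 2 - 1) - 4 * r * ρ * y ^ 3 := by
  have hρs : ρ ≤ s := by nlinarith
  have hrs : r ≤ s := by nlinarith
  have hx1 : x ≤ 1 := by nlinarith
  have hy1 : y ≤ 1 := by nlinarith
  have hx := cube_le_sq_of_le_one hx0 hx1
  have hy := cube_le_sq_of_le_one hy0 hy1
  have h1 : (2 * r * (1 - x ^ 3) + s) ^ 2 < (k - 2 * r * x ^ 3) ^ 2 := by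
    have : 0 ≤ 2 * r * (1 - x ^ 3) :=
      mul_nonneg (by positivity) (by nlinarith)
    apply pow_lt_pow_left₀ _ (by positivity) (by norm_num)
    linarith
  have h2 : r * (ρ * y ^ 3) ≤ r * (s * y ^ 3) := by gcongr
  have h3 : r * (r * (1 - x ^ 3 - y ^ 3)) ≤ r * (s * (1 - x ^ 3 - y ^ 3)) := by
    gcongr; linarith
  have h4 : 0 ≤ r ^ 2 * (6 - 12 * x ^ 3 - 4 * y ^ 3 + 6 * x ^ 2) :=
    mul_nonneg (by positivity) (by nlinarith)
  linarith

lemma abs_mul_cos_add_mul_sin_le (a b u : ℝ) :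
    |a * Real.cos u + b * Real.sin u| ≤ Real.sqrt (a ^ 2 + b ^ 2) := by
  apply Real.abs_le_sqrt
  nlinarith [sq_nonneg (a * Real.sin u - b * Real.cos u), Real.sin_sq_add_cos_sq u]

lemma fP_ne_zero_and_gP_ne_zero {a b c r u v : ℝ} (hr : 0 < r)
    (h : Real.sqrt (a ^ 2 + b ^ 2) > 2 * r + Real.sqrt (c ^ 2 + r ^ 2) ∨
         |c| > 2 * r + Real.sqrt (a ^ 2 + b ^ 2 + r ^ 2))
    (hv : v ∈ Set.Icc (0 : ℝ) Real.pi) :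
    fP a b c r v ≠ 0 ∧ gP a b c r u v ≠ 0 := by
  have hy0 : 0 ≤ Real.sin v := Real.sin_nonneg_of_mem_Icc hv
  have hT := abs_le.1 (abs_mul_cos_add_mul_sin_le a b u)
  have hρ := Real.sqrt_nonneg (a ^ 2 + b ^ 2)
  have hρ2 : Real.sqrt (a ^ 2 + b ^ 2) ^ 2 = a ^ 2 + b ^ 2 := Real.sq_sqrt (by positivity)
  have hxy : |Real.cos v| ^ 2 + Real.sin v ^ 2 = 1 := by
    rw [sq_abs]; exact Real.cos_sq_add_sin_sq v
  have hx1 := Real.abs_cos_le_one v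
  unfold fP gP
  rw [Real.cos_two_mul]
  set ρ := Real.sqrt (a ^ 2 + b ^ 2)
  set T := a * Real.cos u + b * Real.sin u
  set x := Real.cos v
  set y := Real.sin v
  have hcx : r * |c * x| = r * (|c| * |x|) := by rw [abs_mul]
  have hcx3 : r * |c * x ^ 3| = r * (|c| * |x| ^ 3) := by rw [abs_mul, abs_pow]
  have hcxl : r * -|c * x| ≤ r * (c * x) := by gcongr; exact neg_abs_le _
  have hcxu : r * (c * x) ≤ r * |c * x| := by gcongr; exact le_abs_self _
  have hcx3l : r * -|c * x ^ 3| ≤ r * (c * x ^ 3) := by gcongr; exact neg_abs_le _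
  have hcx3u : r * (c * x ^ 3) ≤ r * |c * x ^ 3| := by gcongr; exact le_abs_self _
  have hTl : r * (-ρ * y ^ 3) ≤ r * (T * y ^ 3) := by gcongr; exact hT.1
  have hTu : r * (T * y ^ 3) ≤ r * (ρ * y ^ 3) := by gcongr; exact hT.2
  rcases h with h | h
  · have hs2 : Real.sqrt (c ^ 2 + r ^ 2) ^ 2 = |c| ^ 2 + r ^ 2 := by
      rw [Real.sq_sqrt (by positivity), sq_abs]
    have hf := f_bound_neg hr (abs_nonneg c) (Real.sqrt_nonneg _) hs2 (abs_nonneg x) hx1 h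
    have hg := g_bound_neg hr (abs_nonneg c) (Real.sqrt_nonneg _) hs2 (abs_nonneg x) hy0 hxy h
    rw [sq_abs, sq_abs] at hf hg
    exact ⟨ne_of_lt (by linarith), ne_of_lt (by linarith)⟩
  · have hs2 : Real.sqrt (a ^ 2 + b ^ 2 + r ^ 2) ^ 2 = ρ ^ 2 + r ^ 2 := by
      rw [Real.sq_sqrt (by positivity), hρ2]
    have hf := f_bound_pos hr (Real.sqrt_nonneg _) hs2 hx1 h
    have hg := g_bound_pos hr hρ (Real.sqrt_nonneg _) hs2 (abs_nonneg x) hy0 hxy h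
    rw [sq_abs, sq_abs] at hf hg
    exact ⟨ne_of_gt (by linarith), ne_of_gt (by linarith)⟩

theorem stmt_18 (a b c r : ℝ) (hr : 0 < r)
    (h : Real.sqrt (a ^ 2 + b ^ 2) > 2 * r + Real.sqrt (c ^ 2 + r ^ 2) ∨
         |c| > 2 * r + Real.sqrt (a ^ 2 + b ^ 2 + r ^ 2)) :
    (∀ u : ℝ, ∀ v ∈ Set.Icc (0 : ℝ) Real.pi,
      fP a b c r v ≠ 0 ∧ gP a b c r u v ≠ 0) ∧
    parabolicSet a b c r = ∅ := by
  refine ⟨fun u v hv => fP_ne_zero_and_gP_ne_zero hr h hv, ?_⟩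
  rw [Set.eq_empty_iff_forall_notMem]
  rintro q ⟨u, v, hv, -, -, hfg⟩
  obtain ⟨hf, hg⟩ := fP_ne_zero_and_gP_ne_zero (u := u) hr h (Set.Ioo_subset_Icc_self hv)
  exact hfg.elim hf hg
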